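/- Let S = sgp^+⟨a, b | a^k b = ba⟩ with a ≠ b and k ≥ 0. Then S is prefix-automatic if and only if k ≤ 1. Moreover, if k ≥ 2 then S is not even automatic. -/

import Mathlib

/-!  Common definitions, following the conventions of the paper
"Automaticity of one-relator semigroups with length less than or equal to three".

Words over an alphabet `α` are modelled as `List α`; the empty word is `[]`.
The padded alphabet `A(2,$)` is modelled inside `Option α × Option α`,
where `none` plays the role of the padding symbol `$` (the pair `(none, none)`
never occurs in a padded convolution). -/

/-- A regular set of words: one accepted by a DFA with finitely many states. -/
abbrev IsReg {α : Type*} (L : Set (List α)) : Prop :=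
  Language.IsRegular (L : Language α)

/-- Right-padded convolution `(x,y)δᴿ`: align the two words letter by letter
from the left and pad the shorter one on the right with the padding symbol. -/
def padR {α : Type*} (x y : List α) : List (Option α × Option α) :=
  (x.map some ++ List.replicate (y.length - x.length) none).zip
    (y.map some ++ List.replicate (x.length - y.length) none)

/-- Left-padded convolution `(x,y)δᴸ`: align the two words letter by letter
from the right and pad the shorter one on the left with the padding symbol. -/
def padL {α : Type*} (x y : List α) : List (Option α × Option α) :=
  (List.replicate (y.length - x.length) none ++ x.map some).zip
    (List.replicate (x.length - y.length) none ++ y.map some)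

/-- One elementary rewriting step: replace a factor `u` by `v`
for some defining relation `(u, v) ∈ R` (in either direction via `Relation.EqvGen`). -/
def OneStep {α : Type*} (R : Set (List α × List α)) (x y : List α) : Prop :=
  ∃ p u v s, (u, v) ∈ R ∧ x = p ++ u ++ s ∧ y = p ++ v ++ s

/-- Equality of two words in the semigroup `sgp⁺⟨α ∣ R⟩` (resp. the monoid
`sgp⟨α ∣ R⟩`): the congruence on words generated by the relations `R`. -/
def WordEq {α : Type*} (R : Set (List α × List α)) : List α → List α → Prop :=
  Relation.EqvGen (OneStep R)

/-- Expansion of a word over an abstract generating set `β` into a word over the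
presentation alphabet `α`, where `g b` is a word representing the generator `b`. -/
def expandW {α β : Type*} (g : β → List α) (w : List β) : List α :=
  (w.map g).flatten

/-- `(g, L)` is an automatic structure for the semigroup `sgp⁺⟨α ∣ R⟩` with
respect to the finite generating set indexed by `β`:  each generator `b` is the
element of the semigroup represented by the nonempty word `g b`, the language
`L ⊆ β⁺` is regular and maps onto the semigroup, and `L_ε^$` together with all
`L_b^$` (right multiplication, right padding) are regular. -/
structure SgpAutoStruct {α β : Type*} (R : Set (List α × List α))
    (g : β → List α) (L : Set (List β)) : Prop where
  gen_ne : ∀ b, g b ≠ []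
  reg : IsReg L
  ne : ∀ w ∈ L, w ≠ []
  onto : ∀ w : List α, w ≠ [] → ∃ x ∈ L, WordEq R (expandW g x) w
  eq_reg : IsReg {p | ∃ x ∈ L, ∃ y ∈ L,
      WordEq R (expandW g x) (expandW g y) ∧ p = padR x y}
  mul_reg : ∀ b : β, IsReg {p | ∃ x ∈ L, ∃ y ∈ L,
      WordEq R (expandW g x ++ g b) (expandW g y) ∧ p = padR x y}

/-- A prefix-automatic structure for `sgp⁺⟨α ∣ R⟩`: an automatic structure for
which moreover `L'_= = {(x,y)δᴿ : x ∈ L, y ∈ Pref(L), x = y in S}` is regular. -/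
structure SgpPrefixAutoStruct {α β : Type*} (R : Set (List α × List α))
    (g : β → List α) (L : Set (List β)) extends SgpAutoStruct R g L : Prop where
  pre_reg : IsReg {p | ∃ x ∈ L, ∃ y : List β, (∃ z ∈ L, y <+: z) ∧
      WordEq R (expandW g x) (expandW g y) ∧ p = padR x y}

/-- A biautomatic structure for the semigroup `sgp⁺⟨α ∣ R⟩`: the languages
`L_b^$`, `_bL^$`, `^$L_b` and `_b^$L` are regular for every `b ∈ β ∪ {ε}`. -/
structure SgpBiautoStruct {α β : Type*} (R : Set (List α × List α))
    (g : β → List α) (L : Set (List β)) : Prop where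
  gen_ne : ∀ b, g b ≠ []
  reg : IsReg L
  ne : ∀ w ∈ L, w ≠ []
  onto : ∀ w : List α, w ≠ [] → ∃ x ∈ L, WordEq R (expandW g x) w
  eqR_reg : IsReg {p | ∃ x ∈ L, ∃ y ∈ L,
      WordEq R (expandW g x) (expandW g y) ∧ p = padR x y}
  eqL_reg : IsReg {p | ∃ x ∈ L, ∃ y ∈ L,
      WordEq R (expandW g x) (expandW g y) ∧ p = padL x y}
  mulRR_reg : ∀ b : β, IsReg {p | ∃ x ∈ L, ∃ y ∈ L,
      WordEq R (expandW g x ++ g b) (expandW g y) ∧ p = padR x y}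
  mulLR_reg : ∀ b : β, IsReg {p | ∃ x ∈ L, ∃ y ∈ L,
      WordEq R (g b ++ expandW g x) (expandW g y) ∧ p = padR x y}
  mulRL_reg : ∀ b : β, IsReg {p | ∃ x ∈ L, ∃ y ∈ L,
      WordEq R (expandW g x ++ g b) (expandW g y) ∧ p = padL x y}
  mulLL_reg : ∀ b : β, IsReg {p | ∃ x ∈ L, ∃ y ∈ L,
      WordEq R (g b ++ expandW g x) (expandW g y) ∧ p = padL x y}

/-- The semigroup `sgp⁺⟨α ∣ R⟩` is automatic: it admits an automatic structure
over some finite generating set. -/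
def SgpAutomatic {α : Type*} (R : Set (List α × List α)) : Prop :=
  ∃ (β : Type) (_ : Fintype β) (g : β → List α) (L : Set (List β)),
    SgpAutoStruct R g L

/-- The semigroup `sgp⁺⟨α ∣ R⟩` is prefix-automatic. -/
def SgpPrefixAutomatic {α : Type*} (R : Set (List α × List α)) : Prop :=
  ∃ (β : Type) (_ : Fintype β) (g : β → List α) (L : Set (List β)),
    SgpPrefixAutoStruct R g L

/-- The semigroup `sgp⁺⟨α ∣ R⟩` is biautomatic. -/
def SgpBiautomatic {α : Type*} (R : Set (List α × List α)) : Prop :=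
  ∃ (β : Type) (_ : Fintype β) (g : β → List α) (L : Set (List β)),
    SgpBiautoStruct R g L

/-- `(g, L)` is an automatic structure for the monoid `sgp⟨α ∣ R⟩` with respect
to a finite generating set indexed by `β`; generators may represent any element
of the monoid (in particular the identity, represented by the empty word). -/
structure MonAutoStruct {α β : Type*} (R : Set (List α × List α))
    (g : β → List α) (L : Set (List β)) : Prop where
  reg : IsReg L
  ne : ∀ w ∈ L, w ≠ []
  onto : ∀ w : List α, ∃ x ∈ L, WordEq R (expandW g x) w
  eq_reg : IsReg {p | ∃ x ∈ L, ∃ y ∈ L,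
      WordEq R (expandW g x) (expandW g y) ∧ p = padR x y}
  mul_reg : ∀ b : β, IsReg {p | ∃ x ∈ L, ∃ y ∈ L,
      WordEq R (expandW g x ++ g b) (expandW g y) ∧ p = padR x y}

/-- A prefix-automatic structure for the monoid `sgp⟨α ∣ R⟩`. -/
structure MonPrefixAutoStruct {α β : Type*} (R : Set (List α × List α))
    (g : β → List α) (L : Set (List β)) extends MonAutoStruct R g L : Prop where
  pre_reg : IsReg {p | ∃ x ∈ L, ∃ y : List β, (∃ z ∈ L, y <+: z) ∧
      WordEq R (expandW g x) (expandW g y) ∧ p = padR x y}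

/-- A biautomatic structure for the monoid `sgp⟨α ∣ R⟩`. -/
structure MonBiautoStruct {α β : Type*} (R : Set (List α × List α))
    (g : β → List α) (L : Set (List β)) : Prop where
  reg : IsReg L
  ne : ∀ w ∈ L, w ≠ []
  onto : ∀ w : List α, ∃ x ∈ L, WordEq R (expandW g x) w
  eqR_reg : IsReg {p | ∃ x ∈ L, ∃ y ∈ L,
      WordEq R (expandW g x) (expandW g y) ∧ p = padR x y}
  eqL_reg : IsReg {p | ∃ x ∈ L, ∃ y ∈ L,
      WordEq R (expandW g x) (expandW g y) ∧ p = padL x y}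
  mulRR_reg : ∀ b : β, IsReg {p | ∃ x ∈ L, ∃ y ∈ L,
      WordEq R (expandW g x ++ g b) (expandW g y) ∧ p = padR x y}
  mulLR_reg : ∀ b : β, IsReg {p | ∃ x ∈ L, ∃ y ∈ L,
      WordEq R (g b ++ expandW g x) (expandW g y) ∧ p = padR x y}
  mulRL_reg : ∀ b : β, IsReg {p | ∃ x ∈ L, ∃ y ∈ L,
      WordEq R (expandW g x ++ g b) (expandW g y) ∧ p = padL x y}
  mulLL_reg : ∀ b : β, IsReg {p | ∃ x ∈ L, ∃ y ∈ L,
      WordEq R (g b ++ expandW g x) (expandW g y) ∧ p = padL x y}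

/-- The monoid `sgp⟨α ∣ R⟩` is automatic. -/
def MonAutomatic {α : Type*} (R : Set (List α × List α)) : Prop :=
  ∃ (β : Type) (_ : Fintype β) (g : β → List α) (L : Set (List β)),
    MonAutoStruct R g L

/-- The monoid `sgp⟨α ∣ R⟩` is prefix-automatic. -/
def MonPrefixAutomatic {α : Type*} (R : Set (List α × List α)) : Prop :=
  ∃ (β : Type) (_ : Fintype β) (g : β → List α) (L : Set (List β)),
    MonPrefixAutoStruct R g L

/-- The monoid `sgp⟨α ∣ R⟩` is biautomatic. -/
def MonBiautomatic {α : Type*} (R : Set (List α × List α)) : Prop :=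
  ∃ (β : Type) (_ : Fintype β) (g : β → List α) (L : Set (List β)),
    MonBiautoStruct R g L

/-- The defining relations of `S¹ = sgp⁺⟨α, e ∣ R, ea = ae = a, ee = e⟩`,
the monoid obtained from `S = sgp⁺⟨α ∣ R⟩` by adjoining an identity element,
presented as a semigroup over the alphabet `Option α` where `none` is the new
identity letter `e`. -/
def adjoinOne {α : Type*} (R : Set (List α × List α)) :
    Set (List (Option α) × List (Option α)) :=
  {q | ∃ p ∈ R, q = (p.1.map some, p.2.map some)} ∪
    {q | ∃ a : α, q = ([none, some a], [some a])} ∪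
    {q | ∃ a : α, q = ([some a, none], [some a])} ∪
    {([none, none], [none])}

open Classical in
/-- Exponent of `a` in the normal form. -/
noncomputable def cA {α : Type*} (a : α) (k : ℕ) : List α → ℕ
  | [] => 0
  | x :: w => if x = a then 1 + cA a k w else k * cA a k w

open Classical in
/-- Exponent of `b` in the normal form. -/
noncomputable def cB {α : Type*} (a : α) : List α → ℕ
  | [] => 0
  | x :: w => if x = a then cB a w else 1 + cB a w

theorem cB_append {α : Type*} (a : α) (u v : List α) :
    cB a (u ++ v) = cB a u + cB a v := by
  induction u with
  | nil => simp [cB]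
  | cons x u ih =>
    by_cases h : x = a
    · simp [cB, h, ih]
    · simp [cB, h, ih]; omega

theorem cA_append {α : Type*} (a : α) (k : ℕ) (u v : List α) :
    cA a k (u ++ v) = cA a k u + k ^ cB a u * cA a k v := by
  induction u with
  | nil => simp [cB, cA]
  | cons x u ih =>
    by_cases h : x = a
    · simp [cB, cA, h, ih]; ring
    · simp [cB, cA, h, ih]; ring

theorem cA_rep {α : Type*} (a : α) (k n : ℕ) : cA a k (List.replicate n a) = n := by
  induction n with
  | zero => simp [cA]
  | succ n ih => simp [cA, List.replicate_succ, ih]; omega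

theorem cB_rep {α : Type*} (a : α) (n : ℕ) : cB a (List.replicate n a) = 0 := by
  induction n with
  | zero => simp [cB]
  | succ n ih => simp [cB, List.replicate_succ, ih]

theorem cA_repb {α : Type*} (a b : α) (hab : a ≠ b) (k n : ℕ) :
    cA a k (List.replicate n b) = 0 := by
  induction n with
  | zero => simp [cA]
  | succ n ih => simp [cA, List.replicate_succ, ih, hab.symm]

theorem cB_repb {α : Type*} (a b : α) (hab : a ≠ b) (n : ℕ) :
    cB a (List.replicate n b) = n := by
  induction n with
  | zero => simp [cB]
  | succ n ih => simp [cB, List.replicate_succ, ih, hab.symm]; omega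

/-- Normal form words. -/
def nf {α : Type*} (a b : α) (i j : ℕ) : List α := List.replicate i a ++ List.replicate j b

theorem cA_nf {α : Type*} (a b : α) (hab : a ≠ b) (k i j : ℕ) : cA a k (nf a b i j) = i := by
  simp [nf, cA_append, cA_rep, cA_repb _ _ hab]

theorem cB_nf {α : Type*} (a b : α) (hab : a ≠ b) (i j : ℕ) : cB a (nf a b i j) = j := by
  simp [nf, cB_append, cB_rep, cB_repb _ _ hab]

/-- The relation set. -/
def relS {α : Type*} (a b : α) (k : ℕ) : Set (List α × List α) :=
  {(List.replicate k a ++ [b], [b, a])}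

theorem wordEq_inv {α : Type*} (a b : α) (hab : a ≠ b) (k : ℕ) {x y : List α}
    (h : WordEq (relS a b k) x y) : cA a k x = cA a k y ∧ cB a x = cB a y := by
  induction h with
  | rel x y h =>
    obtain ⟨p, u, v, s, huv, rfl, rfl⟩ := h
    simp only [relS, Set.mem_singleton_iff, Prod.mk.injEq] at huv
    obtain ⟨rfl, rfl⟩ := huv
    constructor
    · simp only [cA_append, cB_append, cA_rep, cB_rep, cA, cB, hab.symm, if_true, if_false]
      ring
    · simp [cB_append, cB_rep, cB, hab.symm]
  | refl x => exact ⟨rfl, rfl⟩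
  | symm x y _ ih => exact ⟨ih.1.symm, ih.2.symm⟩
  | trans x y z _ _ ih1 ih2 => exact ⟨ih1.1.trans ih2.1, ih1.2.trans ih2.2⟩

theorem wordEq_append {α : Type*} {R : Set (List α × List α)} {x y : List α}
    (h : WordEq R x y) (p s : List α) : WordEq R (p ++ x ++ s) (p ++ y ++ s) := by
  induction h with
  | rel x y h =>
    obtain ⟨p', u, v, s', huv, rfl, rfl⟩ := h
    exact Relation.EqvGen.rel _ _ ⟨p ++ p', u, v, s' ++ s, huv, by simp, by simp⟩
  | refl x => exact Relation.EqvGen.refl _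
  | symm x y _ ih => exact Relation.EqvGen.symm _ _ ih
  | trans x y z _ _ ih1 ih2 => exact Relation.EqvGen.trans _ _ _ ih1 ih2

theorem wordEq_b_rep {α : Type*} (a b : α) (k i : ℕ) :
    WordEq (relS a b k) (b :: List.replicate i a) (List.replicate (k * i) a ++ [b]) := by
  induction i with
  | zero => exact Relation.EqvGen.refl _
  | succ i ih =>
    have h1 : WordEq (relS a b k) (b :: List.replicate (i+1) a)
        (List.replicate (k * i) a ++ [b] ++ [a]) := by
      have := wordEq_append ih [] [a]
      simpa [List.replicate_succ'] using this
    have h2 : WordEq (relS a b k) (List.replicate (k * i) a ++ [b] ++ [a])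
        (List.replicate (k * (i+1)) a ++ [b]) := by
      refine Relation.EqvGen.symm _ _ (Relation.EqvGen.rel _ _
        ⟨List.replicate (k*i) a, List.replicate k a ++ [b], [b, a], [], rfl, ?_, ?_⟩)
      · rw [mul_add, mul_one, List.replicate_add]; simp only [List.append_nil, List.append_assoc]
      · simp
    exact Relation.EqvGen.trans _ _ _ h1 h2

theorem wordEq_nf {α : Type*} (a b : α) (hA : ∀ x : α, x = a ∨ x = b) (hab : a ≠ b) (k : ℕ)
    (w : List α) : WordEq (relS a b k) w (nf a b (cA a k w) (cB a w)) := by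
  induction w with
  | nil => exact Relation.EqvGen.refl _
  | cons x w ih =>
    have h1 := wordEq_append ih [x] []
    simp only [List.append_nil, List.singleton_append] at h1
    rcases hA x with rfl | rfl
    · convert h1 using 1
      simp [nf, cA, cB, add_comm 1, List.replicate_succ]
    · refine Relation.EqvGen.trans _ _ _ h1 ?_
      have h2 := wordEq_append (wordEq_b_rep a x k (cA a k w)) [] (List.replicate (cB a w) x)
      have e1 : x :: nf a x (cA a k w) (cB a w)
          = [] ++ x :: List.replicate (cA a k w) a ++ List.replicate (cB a w) x := by simp [nf]
      have e2 : nf a x (cA a k (x :: w)) (cB a (x :: w))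
          = [] ++ (List.replicate (k * cA a k w) a ++ [x]) ++ List.replicate (cB a w) x := by
        simp [nf, cA, cB, hab.symm, add_comm 1, List.replicate_succ]
      rw [e1, e2]
      exact h2

theorem wordEq_iff {α : Type*} (a b : α) (hA : ∀ x : α, x = a ∨ x = b) (hab : a ≠ b) (k : ℕ)
    (x y : List α) :
    WordEq (relS a b k) x y ↔ cA a k x = cA a k y ∧ cB a x = cB a y := by
  refine ⟨wordEq_inv a b hab k, fun h => ?_⟩
  have h1 := wordEq_nf a b hA hab k x
  have h2 := wordEq_nf a b hA hab k y
  rw [h.1, h.2] at h1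
  exact Relation.EqvGen.trans _ _ _ h1 (Relation.EqvGen.symm _ _ h2)

/-! Padding -/

theorem padR_cons {α : Type*} (c d : α) (x y : List α) :
    padR (c :: x) (d :: y) = (some c, some d) :: padR x y := by
  simp [padR]

theorem padR_nil_left {α : Type*} (y : List α) :
    padR [] y = y.map (fun c => (none, some c)) := by
  induction y with
  | nil => simp [padR]
  | cons c y ih => simpa [padR, List.replicate_succ] using ih

theorem padR_nil_right {α : Type*} (y : List α) :
    padR y [] = y.map (fun c => (some c, none)) := by
  induction y with
  | nil => simp [padR]
  | cons c y ih => simpa [padR, List.replicate_succ] using ih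

theorem padR_append {α : Type*} (u v x y : List α) (h : u.length = v.length) :
    padR (u ++ x) (v ++ y) = padR u v ++ padR x y := by
  induction u generalizing v with
  | nil =>
    obtain rfl : v = [] := by simpa using h.symm
    simp [padR_nil_left]
  | cons c u ih =>
    cases v with
    | nil => simp at h
    | cons d v => simp [padR_cons, ih v (by simpa using h)]

theorem padR_self {α : Type*} (x : List α) : padR x x = x.map (fun c => (some c, some c)) := by
  induction x with
  | nil => simp [padR]
  | cons c x ih => simp [padR_cons, ih]

theorem padR_fst {α : Type*} (x y : List α) : (padR x y).filterMap Prod.fst = x := by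
  induction x generalizing y with
  | nil => simp [padR_nil_left]
  | cons c x ih =>
    cases y with
    | nil => 
      rw [padR_nil_right, List.filterMap_map]
      exact List.filterMap_some
    | cons d y => simp [padR_cons, ih]

theorem padR_snd {α : Type*} (x y : List α) : (padR x y).filterMap Prod.snd = y := by
  induction x generalizing y with
  | nil =>
    rw [padR_nil_left, List.filterMap_map]
    exact List.filterMap_some
  | cons c x ih =>
    cases y with
    | nil => simp [padR_nil_right]
    | cons d y => simp [padR_cons, ih]

theorem padR_inj {α : Type*} {x y x' y' : List α} (h : padR x y = padR x' y') :
    x = x' ∧ y = y' :=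
  ⟨by rw [← padR_fst x y, h, padR_fst], by rw [← padR_snd x y, h, padR_snd]⟩

/-! Pumping -/

theorem pump_left {β : Type} (L : Set (List β)) (P : List β → List β → Prop)
    (h : IsReg {p | ∃ x ∈ L, ∃ y ∈ L, P x y ∧ p = padR x y}) :
    ∃ N : ℕ, ∀ x ∈ L, ∀ y ∈ L, P x y → y.length + N ≤ x.length →
      ∃ x' ∈ L, P x' y ∧ x'.length < x.length := by
  obtain ⟨σ, _, M, hM⟩ := h
  refine ⟨Fintype.card σ, fun x hx y hy hP hlen => ?_⟩
  have hmem : padR x y ∈ M.accepts := by rw [hM]; exact ⟨x, hx, y, hy, hP, rfl⟩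
  obtain ⟨x0, x1, rfl, hl⟩ : ∃ x0 x1, x = x0 ++ x1 ∧ x0.length = y.length :=
    ⟨x.take y.length, x.drop y.length, by simp, by simp; omega⟩
  have hp : ∀ z, padR (x0 ++ z) y = padR x0 y ++ z.map (fun c => (some c, none)) := by
    intro z
    have := padR_append x0 y z [] hl
    rwa [List.append_nil, padR_nil_right] at this
  rw [hp, DFA.mem_accepts, DFA.eval, DFA.evalFrom_of_append] at hmem
  obtain ⟨q, u, v, w, huvw, -, hv, h1, h2, h3⟩ := M.evalFrom_split
    (x := x1.map (fun c => (some c, (none : Option β))))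
    (s := M.evalFrom M.start (padR x0 y)) (by simp at hlen ⊢; omega) rfl
  rw [List.map_eq_append_iff] at huvw
  obtain ⟨x2, w', rfl, huv, rfl⟩ := huvw
  rw [List.map_eq_append_iff] at huv
  obtain ⟨u', v', rfl, rfl, rfl⟩ := huv
  have hnew : padR (x0 ++ (u' ++ w')) y ∈ M.accepts := by
    rw [hp, DFA.mem_accepts, DFA.eval, DFA.evalFrom_of_append, List.map_append,
      DFA.evalFrom_of_append, h1, h3]
    exact hmem
  rw [hM] at hnew
  obtain ⟨x', hx', y', hy', hP', he⟩ := hnew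
  obtain ⟨rfl, rfl⟩ := padR_inj he
  refine ⟨_, hx', hP', ?_⟩
  have : 0 < v'.length := by
    rw [List.length_pos_iff]; rintro rfl; simp at hv
  simp; omega

theorem pump_right {β : Type} (L : Set (List β)) (P : List β → List β → Prop)
    (h : IsReg {p | ∃ x ∈ L, ∃ y ∈ L, P x y ∧ p = padR x y}) :
    ∃ N : ℕ, ∀ y ∈ L, ∀ x ∈ L, P y x → y.length + N ≤ x.length →
      ∃ x' ∈ L, P y x' ∧ x'.length < x.length := by
  obtain ⟨σ, _, M, hM⟩ := h
  refine ⟨Fintype.card σ, fun y hy x hx hP hlen => ?_⟩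
  have hmem : padR y x ∈ M.accepts := by rw [hM]; exact ⟨y, hy, x, hx, hP, rfl⟩
  obtain ⟨x0, x1, rfl, hl⟩ : ∃ x0 x1, x = x0 ++ x1 ∧ x0.length = y.length :=
    ⟨x.take y.length, x.drop y.length, by simp, by simp; omega⟩
  have hp : ∀ z, padR y (x0 ++ z) = padR y x0 ++ z.map (fun c => (none, some c)) := by
    intro z
    have := padR_append y x0 [] z hl.symm
    rwa [List.append_nil, padR_nil_left] at this
  rw [hp, DFA.mem_accepts, DFA.eval, DFA.evalFrom_of_append] at hmem
  obtain ⟨q, u, v, w, huvw, -, hv, h1, h2, h3⟩ := M.evalFrom_split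
    (x := x1.map (fun c => ((none : Option β), some c)))
    (s := M.evalFrom M.start (padR y x0)) (by simp at hlen ⊢; omega) rfl
  rw [List.map_eq_append_iff] at huvw
  obtain ⟨x2, w', rfl, huv, rfl⟩ := huvw
  rw [List.map_eq_append_iff] at huv
  obtain ⟨u', v', rfl, rfl, rfl⟩ := huv
  have hnew : padR y (x0 ++ (u' ++ w')) ∈ M.accepts := by
    rw [hp, DFA.mem_accepts, DFA.eval, DFA.evalFrom_of_append, List.map_append,
      DFA.evalFrom_of_append, h1, h3]
    exact hmem
  rw [hM] at hnew
  obtain ⟨y', hy', x', hx', hP', he⟩ := hnew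
  obtain ⟨rfl, rfl⟩ := padR_inj he
  refine ⟨_, hx', hP', ?_⟩
  have : 0 < v'.length := by
    rw [List.length_pos_iff]; rintro rfl; simp at hv
  simp; omega

/-! Regular languages -/

theorem reg_of_family {γ : Type*} (F : Set (Set (List γ))) (hF : F.Finite)
    (hstep : ∀ K ∈ F, ∀ c, {w | c :: w ∈ K} ∈ F) (K : Set (List γ)) (hK : K ∈ F) : IsReg K := by
  refine Language.IsRegular.of_finite_range_leftQuotient (hF.subset ?_)
  rintro _ ⟨x, rfl⟩
  have : ∀ (x : List γ) (K : Set (List γ)), K ∈ F → {w | x ++ w ∈ K} ∈ F := by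
    intro x
    induction x with
    | nil => intro K hK; exact hK
    | cons c x ih => intro K hK; exact ih _ (hstep K hK c)
  exact this x K hK

theorem reg_nil {γ : Type*} : IsReg {w : List γ | w = []} := by
  refine reg_of_family {∅, {w : List γ | w = []}} (by simp) ?_ _ (by simp)
  rintro K (rfl | rfl) c
  · left; rfl
  · left; ext w; simp

theorem reg_fam {γ : Type*} {K : Set (List γ)} (h : IsReg K) :
    ∃ F : Set (Set (List γ)), F.Finite ∧ K ∈ F ∧ ∀ K ∈ F, ∀ c, {w | c :: w ∈ K} ∈ F := by
  refine ⟨Set.range (Language.leftQuotient K), h.finite_range_leftQuotient, ⟨[], rfl⟩, ?_⟩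
  rintro _ ⟨x, rfl⟩ c
  refine ⟨x ++ [c], ?_⟩
  ext w
  change (x ++ [c]) ++ w ∈ K ↔ x ++ (c :: w) ∈ K
  simp

theorem reg_cons {γ : Type*} (c : γ) {K : Set (List γ)} (h : IsReg K) :
    IsReg {w | ∃ v ∈ K, w = c :: v} := by
  obtain ⟨F, hF, hK, hs⟩ := reg_fam h
  refine reg_of_family (insert {w | ∃ v ∈ K, w = c :: v} (insert ∅ F))
    ((hF.insert _).insert _) ?_ _ (Set.mem_insert _ _)
  rintro K' (rfl | rfl | hK') d
  · by_cases hd : d = c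
    · right; right
      convert hK using 1
      ext w; simp [hd]
    · right; left
      ext w; simp [hd]
  · right; left; rfl
  · right; right; exact hs _ hK' d

theorem reg_app {γ : Type*} (m : List γ) {K : Set (List γ)} (h : IsReg K) :
    IsReg {w | ∃ v ∈ K, w = m ++ v} := by
  induction m with
  | nil => simpa using h
  | cons c m ih =>
    convert reg_cons c ih using 1
    ext w
    simp

theorem reg_star {γ : Type*} (c : γ) {K : Set (List γ)} (h : IsReg K) :
    IsReg {w | ∃ i : ℕ, ∃ v ∈ K, w = List.replicate i c ++ v} := by
  obtain ⟨F, hF, hK, hs⟩ := reg_fam h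
  set S := {w | ∃ i : ℕ, ∃ v ∈ K, w = List.replicate i c ++ v} with hS
  have hSstep : ∀ d w, d :: w ∈ S ↔ d :: w ∈ K ∨ (d = c ∧ w ∈ S) := by
    intro d w
    constructor
    · rintro ⟨i, v, hv, he⟩
      cases i with
      | zero => left; simp at he; rw [he]; exact hv
      | succ i =>
        right
        simp [List.replicate_succ] at he
        exact ⟨he.1, i, v, hv, he.2⟩
    · rintro (h | ⟨rfl, i, v, hv, rfl⟩)
      · exact ⟨0, _, h, rfl⟩
      · exact ⟨i + 1, v, hv, by simp [List.replicate_succ]⟩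
  have hder : ∀ T ⊆ F, ∀ d, ∃ T' ⊆ F, {w | d :: w ∈ ⋃₀ T} = ⋃₀ T' := by
    intro T hT d
    refine ⟨Set.image (fun K => {w | d :: w ∈ K}) T, ?_, ?_⟩
    · rintro _ ⟨K', hK', rfl⟩; exact hs _ (hT hK') d
    · ext w; simp
  refine reg_of_family (Set.image (fun T => ⋃₀ T) (𝒫 F) ∪ Set.image (fun T => S ∪ ⋃₀ T) (𝒫 F))
    ((hF.finite_subsets.image _).union (hF.finite_subsets.image _)) ?_ S ?_
  · rintro _ (⟨T, hT, rfl⟩ | ⟨T, hT, rfl⟩) d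
    · obtain ⟨T', hT', he⟩ := hder T hT d
      left; exact ⟨T', hT', he.symm⟩
    · obtain ⟨T', hT', he⟩ := hder (insert K T) (Set.insert_subset hK hT) d
      by_cases hd : d = c
      · right
        refine ⟨T', hT', ?_⟩
        simp only [← he]
        ext w
        simp only [Set.mem_union, Set.mem_ofPred_eq, Set.sUnion_insert, hSstep, hd]
        tauto
      · left
        refine ⟨T', hT', ?_⟩
        simp only [← he]
        ext w
        simp only [Set.mem_union, Set.mem_ofPred_eq, Set.sUnion_insert, hSstep, hd]
        tauto
  · right
    exact ⟨∅, by simp, by simp⟩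

theorem reg_one {γ : Type*} (c : γ) (n : List γ) :
    IsReg {w | ∃ i : ℕ, w = List.replicate i c ++ n} := by
  convert reg_star c (reg_app n reg_nil) using 1
  ext w; simp

theorem reg_two {γ : Type*} (c d : γ) (m n : List γ) :
    IsReg {w | ∃ i j : ℕ, w = List.replicate i c ++ (m ++ (List.replicate j d ++ n))} := by
  convert reg_star c (reg_app m (reg_one d n)) using 1
  ext w; simp

theorem reg_union {γ : Type*} {K K' : Set (List γ)} (h : IsReg K) (h' : IsReg K') :
    IsReg {w | w ∈ K ∨ w ∈ K'} := Language.IsRegular.add h h'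

/-! Not automatic for `k ≥ 2` -/

theorem expandW_append {α β : Type*} (g : β → List α) (u v : List β) :
    expandW g (u ++ v) = expandW g u ++ expandW g v := by
  simp [expandW]

theorem expand_bound {α β : Type*} [Fintype β] (a : α) (k : ℕ) (g : β → List α) (x : List β)
    (h : cB a (expandW g x) = 0) :
    cA a k (expandW g x) ≤ (∑ c, cA a k (g c)) * x.length := by
  induction x with
  | nil => simp [expandW, cA]
  | cons c x ih =>
    have e : expandW g (c :: x) = g c ++ expandW g x := by simp [expandW]
    rw [e] at h ⊢
    rw [cB_append] at h
    rw [cA_append, show cB a (g c) = 0 by omega, pow_zero, one_mul, List.length_cons, mul_add,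
      mul_one]
    have h1 := ih (by omega)
    have h2 : cA a k (g c) ≤ ∑ c, cA a k (g c) :=
      Finset.single_le_sum (f := fun c => cA a k (g c)) (fun _ _ => Nat.zero_le _)
        (Finset.mem_univ c)
    omega

/-- `w` is represented by a word of `L` of length at most `n`. -/
def RepLen {α β : Type*} (R : Set (List α × List α)) (g : β → List α) (L : Set (List β))
    (w : List α) (n : ℕ) : Prop :=
  ∃ x ∈ L, WordEq R (expandW g x) w ∧ x.length ≤ n

theorem exists_min {α β : Type*} {R : Set (List α × List α)} {g : β → List α} {L : Set (List β)}
    (h : SgpAutoStruct R g L) (w : List α) (hw : w ≠ []) :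
    ∃ x ∈ L, WordEq R (expandW g x) w ∧
      ∀ x' ∈ L, WordEq R (expandW g x') w → x.length ≤ x'.length := by
  obtain ⟨x0, h0, h0'⟩ := h.onto w hw
  obtain ⟨x, hx, hm⟩ := WellFounded.has_min (measure (List.length (α := β))).wf
    {x | x ∈ L ∧ WordEq R (expandW g x) w} ⟨x0, h0, h0'⟩
  exact ⟨x, hx.1, hx.2, fun x' h1 h2 => not_lt.1 (hm x' ⟨h1, h2⟩)⟩

section
variable {α β : Type} [Fintype β] {a b : α} {k : ℕ} {g : β → List α} {L : Set (List β)}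

theorem rep_up (hA : ∀ x : α, x = a ∨ x = b) (hab : a ≠ b)
    (h : SgpAutoStruct (relS a b k) g L) :
    ∃ N, ∀ (c : β) (w : List α) (n : ℕ), RepLen (relS a b k) g L w n →
      RepLen (relS a b k) g L (w ++ g c) (n + N) := by
  choose N hN using fun c => pump_right L _ (h.mul_reg c)
  refine ⟨∑ c, N c, fun c w n ⟨x, hx, hxw, hl⟩ => ?_⟩
  obtain ⟨y, hy, hyw, hmin⟩ := exists_min h (w ++ g c) (by simp [h.gen_ne c])
  refine ⟨y, hy, hyw, ?_⟩
  have h2 : N c ≤ ∑ c, N c :=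
    Finset.single_le_sum (f := N) (fun _ _ => Nat.zero_le _) (Finset.mem_univ c)
  by_contra hlt
  have hxy : WordEq (relS a b k) (expandW g x ++ g c) (expandW g y) :=
    (wordEq_append hxw [] (g c)).trans _ _ _ (hyw.symm _ _)
  obtain ⟨y', hy', hP, hlen⟩ := hN c x hx y hy hxy (by omega)
  have := hmin y' hy' (((hP.symm _ _).trans _ _ _ hxy).trans _ _ _ hyw)
  omega

theorem cancel_right (hA : ∀ x : α, x = a ∨ x = b) (hab : a ≠ b) (hk : 1 ≤ k) (u v w : List α)
    (h : WordEq (relS a b k) (u ++ w) (v ++ w)) : WordEq (relS a b k) u v := by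
  rw [wordEq_iff a b hA hab] at h ⊢
  simp only [cA_append, cB_append] at h
  have h2 : cB a u = cB a v := by omega
  rw [h2] at h
  omega

theorem rep_down (hA : ∀ x : α, x = a ∨ x = b) (hab : a ≠ b) (hk : 1 ≤ k)
    (h : SgpAutoStruct (relS a b k) g L) :
    ∃ N, ∀ (c : β) (w : List α) (n : ℕ), w ≠ [] → RepLen (relS a b k) g L (w ++ g c) n →
      RepLen (relS a b k) g L w (n + N) := by
  choose N hN using fun c => pump_left L _ (h.mul_reg c)
  refine ⟨∑ c, N c, fun c w n hw ⟨y, hy, hyw, hl⟩ => ?_⟩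
  obtain ⟨x, hx, hxw, hmin⟩ := exists_min h w hw
  refine ⟨x, hx, hxw, ?_⟩
  have h2 : N c ≤ ∑ c, N c :=
    Finset.single_le_sum (f := N) (fun _ _ => Nat.zero_le _) (Finset.mem_univ c)
  by_contra hlt
  have hxy : WordEq (relS a b k) (expandW g x ++ g c) (expandW g y) :=
    (wordEq_append hxw [] (g c)).trans _ _ _ (hyw.symm _ _)
  obtain ⟨x', hx', hP, hlen⟩ := hN c x hx y hy hxy (by omega)
  have := hmin x' hx' ((cancel_right hA hab hk _ _ _
    (hP.trans _ _ _ (hxy.symm _ _))).trans _ _ _ hxw)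
  omega

theorem RepLen.congr {R : Set (List α × List α)} {u v : List α} {n m : ℕ} (h : RepLen R g L u n)
    (huv : WordEq R u v) (hnm : n ≤ m) : RepLen R g L v m := by
  obtain ⟨x, hx, h1, h2⟩ := h
  exact ⟨x, hx, h1.trans _ _ _ huv, h2.trans hnm⟩

/-- Both Lipschitz bounds, for multiplication by an arbitrary fixed word. -/
theorem rep_word (hA : ∀ x : α, x = a ∨ x = b) (hab : a ≠ b) (hk : 1 ≤ k)
    (h : SgpAutoStruct (relS a b k) g L) (v : List α) (hv : v ≠ []) :
    ∃ N, ∀ (w : List α) (n : ℕ),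
      (RepLen (relS a b k) g L w n → RepLen (relS a b k) g L (w ++ v) (n + N)) ∧
      (w ≠ [] → RepLen (relS a b k) g L (w ++ v) n → RepLen (relS a b k) g L w (n + N)) := by
  obtain ⟨z, -, hz⟩ := h.onto v hv
  obtain ⟨N1, h1⟩ := rep_up hA hab h
  obtain ⟨N2, h2⟩ := rep_down hA hab hk h
  have key : ∀ (z : List β) (w : List α) (n : ℕ),
      (RepLen (relS a b k) g L w n →
        RepLen (relS a b k) g L (w ++ expandW g z) (n + (N1 + N2) * z.length)) ∧
      (w ≠ [] → RepLen (relS a b k) g L (w ++ expandW g z) n →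
        RepLen (relS a b k) g L w (n + (N1 + N2) * z.length)) := by
    intro z
    induction z with
    | nil => intro w n; simp [expandW]
    | cons c z ih =>
      intro w n
      have e : w ++ expandW g (c :: z) = (w ++ g c) ++ expandW g z := by simp [expandW]
      rw [e, List.length_cons, mul_add, mul_one]
      constructor
      · intro hr
        exact ((ih (w ++ g c) _).1 (h1 c w n hr)).congr (Relation.EqvGen.refl _) (by omega)
      · intro hw hr
        exact (h2 c w _ hw ((ih (w ++ g c) n).2 (by simp [hw]) hr)).congr
          (Relation.EqvGen.refl _) (by omega)
  refine ⟨(N1 + N2) * z.length, fun w n => ⟨fun hr => ?_, fun hw hr => ?_⟩⟩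
  · refine ((key z w n).1 hr).congr ?_ le_rfl
    simpa using wordEq_append hz w []
  · refine (key z w n).2 hw (hr.congr ?_ le_rfl)
    simpa using wordEq_append (hz.symm _ _) w []

end

theorem not_auto {α : Type} {a b : α} {k : ℕ} (hA : ∀ x : α, x = a ∨ x = b) (hab : a ≠ b)
    (hk : 2 ≤ k) : ¬ SgpAutomatic (relS a b k) := by
  rintro ⟨β, _, g, L, h⟩
  obtain ⟨Na, ha⟩ := rep_word hA hab (by omega) h [a] (by simp)
  obtain ⟨Nb, hb⟩ := rep_word hA hab (by omega) h [b] (by simp)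
  obtain ⟨x0, hx0, hxb⟩ := h.onto [b] (by simp)
  have r1 : ∀ j : ℕ, RepLen (relS a b k) g L (List.replicate (j+1) b) (x0.length + Nb * j) := by
    intro j
    induction j with
    | zero => exact ⟨x0, hx0, hxb, by simp⟩
    | succ j ih =>
      have := (hb _ _).1 ih
      rw [← List.replicate_succ'] at this
      exact this.congr (Relation.EqvGen.refl _) (by rw [mul_add]; omega)
  have r2 : ∀ (j n : ℕ) (w : List α), w ≠ [] →
      RepLen (relS a b k) g L (w ++ List.replicate j b) n → RepLen (relS a b k) g L w (n + Nb * j) := by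
    intro j
    induction j with
    | zero => intro n w _ hr; simpa using hr
    | succ j ih =>
      intro n w hw hr
      rw [List.replicate_succ', ← List.append_assoc] at hr
      exact (ih _ w hw ((hb _ _).2 (by simp [hw]) hr)).congr (Relation.EqvGen.refl _)
        (by rw [mul_add]; omega)
  set C := ∑ c, cA a k (g c) with hC
  have r3 : ∀ j : ℕ, k ^ (j+1) ≤ C * (x0.length + Nb * j + Na + Nb * (j+1)) := by
    intro j
    have s1 := (ha _ _).1 (r1 j)
    have s2 : RepLen (relS a b k) g L (List.replicate (k^(j+1)) a ++ List.replicate (j+1) b)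
        (x0.length + Nb * j + Na) := by
      refine s1.congr ?_ le_rfl
      rw [wordEq_iff a b hA hab]
      simp [cA_append, cB_append, cA_rep, cB_rep, cA_repb _ _ hab, cB_repb _ _ hab, cA, cB]
    obtain ⟨x, hx, hxw, hl⟩ := r2 _ _ _ (by simp; omega) s2
    rw [wordEq_iff a b hA hab, cA_rep, cB_rep] at hxw
    have := expand_bound a k g x hxw.2
    rw [hxw.1] at this
    exact this.trans (Nat.mul_le_mul_left _ hl)
  obtain ⟨E, hE⟩ : ∃ E, E = C * (x0.length + Na + 2 * Nb) := ⟨_, rfl⟩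
  have r4 : ∀ m : ℕ, 1 ≤ m → 2 ^ m ≤ E * (m + 1) := by
    intro m hm
    obtain ⟨j, rfl⟩ := Nat.exists_eq_add_of_le' hm
    calc 2 ^ (j+1) ≤ k ^ (j+1) := Nat.pow_le_pow_left hk _
      _ ≤ _ := r3 j
      _ ≤ E * (j + 1 + 1) := by
        rw [hE, mul_assoc]
        refine Nat.mul_le_mul_left _ ?_
        nlinarith [Nat.zero_le (x0.length * j), Nat.zero_le (Na * j), Nat.zero_le (Nb * j)]
  have h5 := r4 (2 * (2 * E + 1)) (by omega)
  have h6 : 2 * E + 1 + 1 ≤ 2 ^ (2 * E + 1) := Nat.lt_two_pow_self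
  have h7 : 2 ^ (2 * (2 * E + 1)) = 2 ^ (2 * E + 1) * 2 ^ (2 * E + 1) := by
    rw [two_mul (2 * E + 1), pow_add]
  rw [h7] at h5
  nlinarith [Nat.mul_le_mul h6 h6]

/-! Prefix-automatic for `k ≤ 1` -/

theorem expandW_single {α : Type*} (x : List α) : expandW (fun c : α => [c]) x = x := by
  induction x with
  | nil => rfl
  | cons c x ih => simpa [expandW] using ih

/-- The language of nonempty normal forms. -/
def nfL {α : Type*} (a b : α) : Set (List α) := {w | ∃ i j, 0 < i + j ∧ w = nf a b i j}

theorem reg_diag {γ : Type*} (c d : γ) (n : List γ) :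
    IsReg {w | ∃ i j : ℕ, 0 < i + j ∧
      w = List.replicate i c ++ (List.replicate j d ++ n)} := by
  convert reg_union (reg_two c d [c] n) (reg_one d (d :: n)) using 1
  ext w
  constructor
  · rintro ⟨i, j, hij, rfl⟩
    rcases i with _ | i
    · right
      obtain ⟨j, rfl⟩ : ∃ t, j = t + 1 := ⟨j - 1, by omega⟩
      exact ⟨j, by simp [List.replicate_succ']⟩
    · left
      exact ⟨i, j, by simp [List.replicate_succ']⟩
  · rintro (⟨i, j, rfl⟩ | ⟨j, rfl⟩)
    · exact ⟨i + 1, j, by omega, by simp [List.replicate_succ']⟩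
    · exact ⟨0, j + 1, by omega, by simp [List.replicate_succ']⟩

theorem padR_nf_self {α : Type*} (a b : α) (i j : ℕ) :
    padR (nf a b i j) (nf a b i j) =
      List.replicate i (some a, some a) ++ (List.replicate j (some b, some b) ++ []) := by
  simp [padR_self, nf]

theorem padR_nf_b {α : Type*} (a b : α) (i j : ℕ) :
    padR (nf a b i j) (nf a b i (j+1)) =
      List.replicate i (some a, some a) ++
        (List.replicate j (some b, some b) ++ [(none, some b)]) := by
  have e : nf a b i (j+1) = nf a b i j ++ [b] := by simp [nf, List.replicate_succ']
  have := padR_append (nf a b i j) (nf a b i j) [] [b] rfl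
  rw [List.append_nil] at this
  rw [e, this, padR_nf_self, padR_nil_left]
  simp

theorem padR_nf_a0 {α : Type*} (a b : α) (i : ℕ) :
    padR (nf a b i 0) (nf a b (i+1) 0) =
      List.replicate i (some a, some a) ++ [(none, some a)] := by
  have e : nf a b (i+1) 0 = nf a b i 0 ++ [a] := by simp [nf, List.replicate_succ']
  have := padR_append (nf a b i 0) (nf a b i 0) [] [a] rfl
  rw [List.append_nil] at this
  rw [e, this, padR_nf_self, padR_nil_left]
  simp

theorem padR_nf_a {α : Type*} (a b : α) (i j : ℕ) :
    padR (nf a b i (j+1)) (nf a b (i+1) (j+1)) =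
      List.replicate i (some a, some a) ++ ([(some b, some a)] ++
        (List.replicate j (some b, some b) ++ [(none, some b)])) := by
  have e1 : nf a b i (j+1) = List.replicate i a ++ (b :: List.replicate j b) := by
    simp [nf, List.replicate_succ]
  have e2 : nf a b (i+1) (j+1) =
      List.replicate i a ++ (a :: (List.replicate j b ++ [b])) := by
    simp [nf, List.replicate_succ']
  have := padR_append (List.replicate j b) (List.replicate j b) [] [b] rfl
  rw [List.append_nil] at this
  rw [e1, e2, padR_append _ _ _ _ rfl, padR_cons, padR_self, this, padR_self, padR_nil_left]
  simp

theorem prefix_nf {α : Type*} (a b : α) {i j : ℕ} {y : List α} (h : y <+: nf a b i j) :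
    ∃ i' j', y = nf a b i' j' := by
  rw [List.prefix_iff_eq_take] at h
  refine ⟨min y.length i, min (y.length - i) j, ?_⟩
  conv_lhs => rw [h]
  simp [nf, List.take_append]

theorem pre_auto {α : Type} [Fintype α] {a b : α} {k : ℕ} (hA : ∀ x : α, x = a ∨ x = b)
    (hab : a ≠ b) (hk : k ≤ 1) : SgpPrefixAutomatic (relS a b k) := by
  have hnf : ∀ i j i' j', WordEq (relS a b k) (nf a b i j) (nf a b i' j') ↔ i = i' ∧ j = j' := by
    intro i j i' j'
    rw [wordEq_iff a b hA hab]
    simp [cA_nf _ _ hab, cB_nf _ _ hab]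
  have hmul : ∀ i j i' j' (c : α), WordEq (relS a b k) (nf a b i j ++ [c]) (nf a b i' j') ↔
      i + k ^ j * cA a k [c] = i' ∧ j + cB a [c] = j' := by
    intro i j i' j' c
    rw [wordEq_iff a b hA hab]
    simp [cA_nf _ _ hab, cB_nf _ _ hab, cA_append, cB_append]
  have heq : IsReg {p | ∃ x ∈ nfL a b, ∃ y ∈ nfL a b,
      WordEq (relS a b k) x y ∧ p = padR x y} := by
    convert reg_diag (some a, some a) (some b, some b) [] using 1
    ext p
    constructor
    · rintro ⟨_, ⟨i, j, hij, rfl⟩, _, ⟨i', j', -, rfl⟩, he, rfl⟩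
      obtain ⟨rfl, rfl⟩ := (hnf _ _ _ _).1 he
      exact ⟨i, j, hij, padR_nf_self a b i j⟩
    · rintro ⟨i, j, hij, rfl⟩
      exact ⟨_, ⟨i, j, hij, rfl⟩, _, ⟨i, j, hij, rfl⟩, Relation.EqvGen.refl _,
        (padR_nf_self a b i j).symm⟩
  have hpre : {p | ∃ x ∈ nfL a b, ∃ y : List α, (∃ z ∈ nfL a b, y <+: z) ∧
      WordEq (relS a b k) x y ∧ p = padR x y} = {p | ∃ x ∈ nfL a b, ∃ y ∈ nfL a b,
      WordEq (relS a b k) x y ∧ p = padR x y} := by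
    ext p
    constructor
    · rintro ⟨_, ⟨i, j, hij, rfl⟩, y, ⟨_, ⟨i', j', -, rfl⟩, hy⟩, he, rfl⟩
      obtain ⟨i'', j'', rfl⟩ := prefix_nf a b hy
      obtain ⟨rfl, rfl⟩ := (hnf _ _ _ _).1 he
      exact ⟨_, ⟨i, j, hij, rfl⟩, _, ⟨i, j, hij, rfl⟩, Relation.EqvGen.refl _, rfl⟩
    · rintro ⟨x, hx, y, hy, he, rfl⟩
      exact ⟨x, hx, y, ⟨y, hy, List.prefix_rfl⟩, he, rfl⟩
  refine ⟨α, inferInstance, fun c => [c], nfL a b, ⟨⟨by simp, ?_, ?_, ?_, ?_, ?_⟩, ?_⟩⟩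
  · convert reg_diag a b [] using 1
    ext w
    simp [nfL, nf]
  · rintro _ ⟨i, j, hij, rfl⟩
    simp [nf]; omega
  · intro w hw
    refine ⟨_, ⟨cA a k w, cB a w, ?_, rfl⟩, ?_⟩
    · cases w with
      | nil => exact absurd rfl hw
      | cons x w =>
        by_cases h : x = a
        · simp [cA, cB, h]
        · simp [cA, cB, h]
    · rw [expandW_single]
      exact (wordEq_nf a b hA hab k w).symm _ _
  · simpa only [expandW_single] using heq
  · intro c
    simp only [expandW_single]
    rcases hA c with rfl | rfl
    · have e1 : cA c k [c] = 1 := by simp [cA]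
      have e2 : cB c [c] = 0 := by simp [cB]
      have hmul := fun i j i' j' => hmul i j i' j' c
      simp only [e1, e2] at hmul
      interval_cases k
      · convert reg_union (reg_one (some c, some c) [(some c, some c), (none, some c)])
          (reg_two (some c, some c) (some b, some b) [(some b, some b)] []) using 1
        ext p
        constructor
        · rintro ⟨_, ⟨i, j, hij, rfl⟩, _, ⟨i', j', -, rfl⟩, he, rfl⟩
          rw [hmul] at he
          obtain ⟨rfl, rfl⟩ := he
          rcases j with _ | j
          · obtain ⟨i, rfl⟩ : ∃ t, i = t + 1 := ⟨i - 1, by omega⟩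
            left
            refine ⟨i, ?_⟩
            simp [padR_nf_a0, List.replicate_succ']
          · right
            refine ⟨i, j, ?_⟩
            simp [padR_nf_self, List.replicate_succ]
        · rintro (⟨i, rfl⟩ | ⟨i, j, rfl⟩)
          · refine ⟨_, ⟨i + 1, 0, by omega, rfl⟩, _, ⟨i + 2, 0, by omega, rfl⟩, ?_, ?_⟩
            · rw [hmul]; simp
            · simp [padR_nf_a0, List.replicate_succ']
          · refine ⟨_, ⟨i, j + 1, by omega, rfl⟩, _, ⟨i, j + 1, by omega, rfl⟩, ?_, ?_⟩
            · rw [hmul]; simp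
            · simp [padR_nf_self, List.replicate_succ]
      · convert reg_union (reg_one (some c, some c) [(some c, some c), (none, some c)])
          (reg_two (some c, some c) (some b, some b) [(some b, some c)] [(none, some b)]) using 1
        ext p
        constructor
        · rintro ⟨_, ⟨i, j, hij, rfl⟩, _, ⟨i', j', -, rfl⟩, he, rfl⟩
          rw [hmul] at he
          obtain ⟨rfl, rfl⟩ := he
          rcases j with _ | j
          · obtain ⟨i, rfl⟩ : ∃ t, i = t + 1 := ⟨i - 1, by omega⟩
            left
            refine ⟨i, ?_⟩
            simp [padR_nf_a0, List.replicate_succ']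
          · right
            refine ⟨i, j, ?_⟩
            simp [padR_nf_a]
        · rintro (⟨i, rfl⟩ | ⟨i, j, rfl⟩)
          · refine ⟨_, ⟨i + 1, 0, by omega, rfl⟩, _, ⟨i + 2, 0, by omega, rfl⟩, ?_, ?_⟩
            · rw [hmul]; simp
            · simp [padR_nf_a0, List.replicate_succ']
          · refine ⟨_, ⟨i, j + 1, by omega, rfl⟩, _, ⟨i + 1, j + 1, by omega, rfl⟩, ?_, ?_⟩
            · rw [hmul]; simp
            · simp [padR_nf_a]
    · have e1 : cA a k [c] = 0 := by simp [cA, hab.symm]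
      have e2 : cB a [c] = 1 := by simp [cB, hab.symm]
      have hmul := fun i j i' j' => hmul i j i' j' c
      simp only [e1, e2] at hmul
      convert reg_diag (some a, some a) (some c, some c) [(none, some c)] using 1
      ext p
      constructor
      · rintro ⟨_, ⟨i, j, hij, rfl⟩, _, ⟨i', j', -, rfl⟩, he, rfl⟩
        rw [hmul] at he
        obtain ⟨rfl, rfl⟩ := he
        exact ⟨i, j, hij, padR_nf_b a c i j⟩
      · rintro ⟨i, j, hij, rfl⟩
        refine ⟨_, ⟨i, j, hij, rfl⟩, _, ⟨i, j + 1, by omega, rfl⟩, ?_, (padR_nf_b a c i j).symm⟩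
        rw [hmul]; simp
  · simp only [expandW_single]
    rw [hpre]
    exact heq

/-- the semigroup `S = sgp⁺⟨a, b ∣ aᵏb = ba⟩` (`k ≥ 0`) is
prefix-automatic if and only if `k ≤ 1`; moreover for `k ≥ 2` it is not even
automatic. -/
theorem statement_10 {α : Type} [Fintype α] (a b : α) (hab : a ≠ b)
    (hA : ∀ x : α, x = a ∨ x = b) (k : ℕ)
    (R : Set (List α × List α))
    (hRdef : R = {(List.replicate k a ++ [b], [b, a])}) :
    (SgpPrefixAutomatic R ↔ k ≤ 1) ∧ (2 ≤ k → ¬ SgpAutomatic R) := by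
  have hR : R = relS a b k := hRdef
  rw [hR]
  refine ⟨⟨fun h => ?_, pre_auto hA hab⟩, not_auto hA hab⟩
  by_contra hk
  obtain ⟨β, hβ, g, L, hL⟩ := h
  exact not_auto hA hab (by omega) ⟨β, hβ, g, L, hL.toSgpAutoStruct⟩
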